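/- Assume ξ is cross-monotone and satisfies the insertion property, and let (J_t)_{t=0}^k be a greedy sequence of length k ≤ |C|. Then for every t = 1,…,k and every j ∈ J_t: ξ(J_t, j) ≥ max_{j'∈C∖J_{t−1}} ξ(J_{t−1}∪{j'}, j'). -/

import Mathlib

open Finset

/-- For a nonnegative, cross-monotone cost-sharing method `ξ` satisfying
the insertion property, along a greedy sequence `(J_t)` of length `k ≤ |C|`, every
client `j ∈ J_t` has cost share `ξ(J_t, j)` at least
`max_{j'∉J_{t−1}} ξ(J_{t−1}∪{j'}, j')`. -/
theorem stmt11 {C : Type*} [Fintype C] [DecidableEq C]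
    (ξ : Finset C → C → ℝ) (hξnn : ∀ J j, 0 ≤ ξ J j)
    (hcross : ∀ (J₁ J₂ : Finset C), J₁ ⊆ J₂ → ∀ j : C, ξ J₂ j ≤ ξ J₁ j)
    (hins : ∀ (J : Finset C) (j₁ : C), j₁ ∈ J → ∀ j₂ : C, j₂ ∉ J →
      min (ξ J j₁) (ξ (insert j₂ J) j₂) ≤ ξ (insert j₂ J) j₁)
    (k : ℕ) (hk : k ≤ Fintype.card C)
    (J : ℕ → Finset C) (jbar : ℕ → C)
    (hJ0 : J 0 = ∅)
    (hgreedy : ∀ t : ℕ, 1 ≤ t → t ≤ k →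
      jbar t ∉ J (t - 1) ∧ J t = insert (jbar t) (J (t - 1)) ∧
      ∀ j' : C, j' ∉ J (t - 1) →
        ξ (insert j' (J (t - 1))) j' ≤ ξ (insert (jbar t) (J (t - 1))) (jbar t)) :
    ∀ t : ℕ, 1 ≤ t → t ≤ k → ∀ j ∈ J t, ∀ j' : C, j' ∉ J (t - 1) →
      ξ (insert j' (J (t - 1))) j' ≤ ξ (J t) j := by
  intro t
  induction t with
  | zero => intro h; omega
  | succ t ih =>
    intro _ htk j hj j' hj'
    obtain ⟨hb, hJ, hmax⟩ := hgreedy (t + 1) (by omega) htk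
    simp only [Nat.add_sub_cancel] at hb hJ hmax hj' ⊢
    have hM := hmax j' hj'
    rw [hJ] at hj ⊢
    rcases Finset.mem_insert.mp hj with rfl | hjt
    · exact hM
    · refine le_trans (le_min ?_ hM) (hins (J t) j hjt (jbar (t + 1)) hb)
      rcases Nat.eq_zero_or_pos t with rfl | ht
      · simp [hJ0] at hjt
      · obtain ⟨_, hJt, _⟩ := hgreedy t ht (by omega)
        have hsub : J (t - 1) ⊆ J t := by
          rw [hJt]; exact Finset.subset_insert _ _
        exact le_trans (hcross _ _ (Finset.insert_subset_insert j' hsub) j')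
          (ih ht (by omega) j hjt j' (fun h => hj' (hsub h)))
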